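/- arXiv:0911.4200 — 2 statements merged into one kernel-verified Lean document; each statement's English description precedes it below -/
import Mathlib

section
/- Let T be an ℝ-tree. If g : T → T is a weak homeomorphism, then for every segment [x,y] ⊆ T the restriction of g to [x,y] is a homeomorphism onto its image g([x,y]) = [g(x), g(y)], for the topology induced by the metric of T. -/
open Set

/-- A topologically embedded arc in `T` joining `x` to `y`, given as a subset:
the image of a continuous injective map on `[0,1]` with endpoints `x` and `y`
(such a map is automatically a topological embedding). -/
def IsArc {T : Type*} [MetricSpace T] (A : Set T) (x y : T) : Prop :=
  ∃ f : ℝ → T, ContinuousOn f (Icc (0 : ℝ) 1) ∧ InjOn f (Icc (0 : ℝ) 1) ∧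
    f '' Icc (0 : ℝ) 1 = A ∧ f 0 = x ∧ f 1 = y

/-- `A ⊆ T` is isometric to a closed bounded interval of `ℝ`. -/
def IsIsometricToInterval {T : Type*} [MetricSpace T] (A : Set T) : Prop :=
  ∃ (a b : ℝ) (f : ℝ → T), a ≤ b ∧
    (∀ s ∈ Icc a b, ∀ t ∈ Icc a b, dist (f s) (f t) = |s - t|) ∧
    f '' Icc a b = A

/-- An `ℝ`-tree: a metric space in which any two distinct points are joined by a
unique topologically embedded arc, and this arc is isometric to a closed bounded
interval of `ℝ`. -/
structure IsRTree (T : Type*) [MetricSpace T] : Prop where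
  arc_existsUnique : ∀ ⦃x y : T⦄, x ≠ y → ∃! A : Set T, IsArc A x y
  arc_isometric : ∀ ⦃x y : T⦄, x ≠ y → ∀ A : Set T, IsArc A x y → IsIsometricToInterval A

open scoped Classical in
/-- The segment `[x,y]`: the unique arc joining `x` to `y` if `x ≠ y`
(computed as the intersection of all such arcs), and `{x}` if `x = y`. -/
noncomputable def seg {T : Type*} [MetricSpace T] (x y : T) : Set T :=
  if x = y then {x} else ⋂₀ {A : Set T | IsArc A x y}

/-- Betweenness: `Btwn x y z` iff `x ∈ [y,z] \ {y,z}`. -/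
def Btwn {T : Type*} [MetricSpace T] (x y z : T) : Prop :=
  x ∈ seg y z ∧ x ≠ y ∧ x ≠ z

/-- A weak homeomorphism of `T`: a bijection preserving the betweenness relation. -/
def IsWeakHomeo {T : Type*} [MetricSpace T] (g : T → T) : Prop :=
  Function.Bijective g ∧ ∀ x y z : T, Btwn x y z ↔ Btwn (g x) (g y) (g z)

/-- Convex subsets (subtrees) of `T`. -/
def ConvexSubtree {T : Type*} [MetricSpace T] (S : Set T) : Prop :=
  ∀ x ∈ S, ∀ y ∈ S, seg x y ⊆ S

/-- The action of `G` on `T` is by weak homeomorphisms. -/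
def ActsByWeakHomeos (G T : Type*) [Group G] [MulAction G T] [MetricSpace T] : Prop :=
  ∀ g : G, IsWeakHomeo (fun t : T => g • t)

/-- The action of `G` on `T` is non-nesting: no segment is mapped properly into itself. -/
def NonNesting (G T : Type*) [Group G] [MulAction G T] [MetricSpace T] : Prop :=
  ∀ (g : G) (x y : T), ¬ ((fun t : T => g • t) '' seg x y ⊂ seg x y)

/-- The fixed-point set `T^g` of a group element. -/
def fixedSet (T : Type*) {G : Type*} [Group G] [MulAction G T] (g : G) : Set T :=
  {t : T | g • t = t}

/-- `x, y, z` span a tripod: the median of `x, y, z` lies in none of `{x,y,z}`. -/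
def IsTripod {T : Type*} [MetricSpace T] (x y z : T) : Prop :=
  ∀ c ∈ seg x y ∩ seg y z ∩ seg z x, c ≠ x ∧ c ≠ y ∧ c ≠ z

/-- `S` contains no tripod. -/
def NoTripod {T : Type*} [MetricSpace T] (S : Set T) : Prop :=
  ¬ ∃ x y z : T, IsTripod x y z ∧ seg x y ∪ seg y z ∪ seg z x ⊆ S

/-- A line: a convex subset containing no tripod, maximal for inclusion. -/
def IsLine {T : Type*} [MetricSpace T] (L : Set T) : Prop :=
  ConvexSubtree L ∧ NoTripod L ∧
    ∀ L' : Set T, ConvexSubtree L' → NoTripod L' → L ⊆ L' → L' = L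

/-- `L` is an axis for `g`: a `g`-invariant line. -/
def IsAxis {G T : Type*} [Group G] [MulAction G T] [MetricSpace T] (g : G) (L : Set T) :
    Prop :=
  IsLine L ∧ (fun t : T => g • t) '' L = L



theorem seg_eq_of_isArc {T : Type*} [MetricSpace T] (hT : IsRTree T) {x y : T} (hxy : x ≠ y)
    {A : Set T} (hA : IsArc A x y) : seg x y = A := by
  unfold seg
  rw [if_neg hxy]
  apply Subset.antisymm
  · exact sInter_subset_of_mem hA
  · apply subset_sInter
    intro B hB
    rw [(hT.arc_existsUnique hxy).unique hB hA]

theorem seg_param {T : Type*} [MetricSpace T] (hT : IsRTree T) {x y : T} (hxy : x ≠ y) :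
    ∃ φ : ℝ → T, (∀ s ∈ Icc (0 : ℝ) (dist x y), ∀ t ∈ Icc (0 : ℝ) (dist x y),
      dist (φ s) (φ t) = |s - t|) ∧ φ '' Icc 0 (dist x y) = seg x y ∧ φ 0 = x ∧
      φ (dist x y) = y := by
  obtain ⟨A, hA, -⟩ := hT.arc_existsUnique hxy
  rw [seg_eq_of_isArc hT hxy hA]
  obtain ⟨a, b, f, hab, hf, hfA⟩ := hT.arc_isometric hxy A hA
  obtain ⟨c, hc, hci, hcA, hc0, hc1⟩ := hA
  have hex : ∀ s : ℝ, ∃ u : ℝ, s ∈ Icc (0 : ℝ) 1 → u ∈ Icc a b ∧ f u = c s := by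
    intro s
    by_cases hs : s ∈ Icc (0 : ℝ) 1
    · have : c s ∈ f '' Icc a b := by rw [hfA, ← hcA]; exact mem_image_of_mem c hs
      obtain ⟨u, hu, hu2⟩ := this
      exact ⟨u, fun _ => ⟨hu, hu2⟩⟩
    · exact ⟨0, fun h => absurd h hs⟩
  choose p hp using hex
  have hd : ∀ s ∈ Icc (0 : ℝ) 1, ∀ t ∈ Icc (0 : ℝ) 1, dist (p s) (p t) = dist (c s) (c t) := by
    intro s hs t ht
    rw [← (hp s hs).2, ← (hp t ht).2, hf _ (hp s hs).1 _ (hp t ht).1, Real.dist_eq]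
  have hpc : ContinuousOn p (Icc 0 1) := by
    rw [Metric.continuousOn_iff] at hc ⊢
    intro s hs ε hε
    obtain ⟨δ, hδ, h⟩ := hc s hs ε hε
    refine ⟨δ, hδ, fun t ht hts => ?_⟩
    rw [hd t ht s hs]
    exact h t ht hts
  have hpi : InjOn p (Icc 0 1) := by
    intro s hs t ht h
    apply hci hs ht
    rw [← (hp s hs).2, ← (hp t ht).2, h]
  have hsurj : ∀ u ∈ Icc a b, ∃ s ∈ Icc (0 : ℝ) 1, p s = u := by
    intro u hu
    have : f u ∈ c '' Icc 0 1 := by rw [hcA, ← hfA]; exact mem_image_of_mem f hu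
    obtain ⟨s, hs, h⟩ := this
    refine ⟨s, hs, ?_⟩
    have h1 := hf _ (hp s hs).1 _ hu
    rw [(hp s hs).2, h, dist_self] at h1
    linarith [abs_eq_zero.mp h1.symm]
  have h0 : (0 : ℝ) ∈ Icc (0 : ℝ) 1 := by simp
  have h1 : (1 : ℝ) ∈ Icc (0 : ℝ) 1 := by simp
  obtain ⟨sa, hsa, hsa'⟩ := hsurj a ⟨le_rfl, hab⟩
  obtain ⟨sb, hsb, hsb'⟩ := hsurj b ⟨hab, le_rfl⟩
  have hfx := (hp 0 h0).2
  have hfy := (hp 1 h1).2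
  have hp0 := (hp 0 h0).1
  have hp1 := (hp 1 h1).1
  have ha : a ∈ Icc a b := ⟨le_rfl, hab⟩
  have hb : b ∈ Icc a b := ⟨hab, le_rfl⟩
  rcases hpc.strictMonoOn_of_injOn_Icc' zero_le_one hpi with hm | hm
  · have e0 : p 0 = a := le_antisymm (hsa' ▸ hm.monotoneOn h0 hsa hsa.1) hp0.1
    have e1 : p 1 = b := le_antisymm hp1.2 (hsb' ▸ hm.monotoneOn hsb h1 hsb.2)
    rw [e0, hc0] at hfx
    rw [e1, hc1] at hfy
    have hD : dist x y = b - a := by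
      rw [← hfx, ← hfy, hf _ ha _ hb, abs_sub_comm, abs_of_nonneg (by linarith)]
    rw [hD]
    refine ⟨fun u => f (a + u), ?_, ?_, by simpa using hfx, by simpa using hfy⟩
    · intro s hs t ht
      rw [hf _ ⟨by linarith [hs.1], by linarith [hs.2]⟩ _ ⟨by linarith [ht.1], by linarith [ht.2]⟩]
      congr 1; ring
    · rw [← hfA]
      ext z
      constructor
      · rintro ⟨u, hu, rfl⟩
        exact ⟨a + u, ⟨by linarith [hu.1], by linarith [hu.2]⟩, rfl⟩
      · rintro ⟨u, hu, rfl⟩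
        exact ⟨u - a, ⟨by linarith [hu.1], by linarith [hu.2]⟩, by simp⟩
  · have e0 : p 0 = b := le_antisymm hp0.2 (hsb' ▸ hm.antitoneOn h0 hsb hsb.1)
    have e1 : p 1 = a := le_antisymm (hsa' ▸ hm.antitoneOn hsa h1 hsa.2) hp1.1
    rw [e0, hc0] at hfx
    rw [e1, hc1] at hfy
    have hD : dist x y = b - a := by
      rw [← hfx, ← hfy, hf _ hb _ ha, abs_of_nonneg (by linarith)]
    rw [hD]
    refine ⟨fun u => f (b - u), ?_, ?_, by simpa using hfx, by simpa using hfy⟩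
    · intro s hs t ht
      rw [hf _ ⟨by linarith [hs.2], by linarith [hs.1]⟩ _ ⟨by linarith [ht.2], by linarith [ht.1]⟩]
      rw [abs_sub_comm s t]
      congr 1; ring
    · rw [← hfA]
      ext z
      constructor
      · rintro ⟨u, hu, rfl⟩
        exact ⟨b - u, ⟨by linarith [hu.2], by linarith [hu.1]⟩, rfl⟩
      · rintro ⟨u, hu, rfl⟩
        exact ⟨b - u, ⟨by linarith [hu.2], by linarith [hu.1]⟩, by simp⟩

theorem seg_self' {T : Type*} [MetricSpace T] (x : T) : seg x x = {x} := by
  simp [seg]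

theorem mem_seg_iff {T : Type*} [MetricSpace T] (hT : IsRTree T) {x y z : T} :
    z ∈ seg x y ↔ z = x ∨ z = y ∨ Btwn z x y := by
  have hx : x ∈ seg x y ∧ y ∈ seg x y := by
    by_cases hxy : x = y
    · subst hxy; simp [seg_self']
    · obtain ⟨φ, -, him, h0, h1⟩ := seg_param hT hxy
      rw [← him]
      exact ⟨⟨0, ⟨le_rfl, dist_nonneg⟩, h0⟩, ⟨_, ⟨dist_nonneg, le_rfl⟩, h1⟩⟩
  constructor
  · intro h
    by_cases h1 : z = x
    · exact Or.inl h1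
    by_cases h2 : z = y
    · exact Or.inr (Or.inl h2)
    exact Or.inr (Or.inr ⟨h, h1, h2⟩)
  · rintro (rfl | rfl | h)
    · exact hx.1
    · exact hx.2
    · exact h.1

theorem mem_seg_map {T : Type*} [MetricSpace T] (hT : IsRTree T)
    {g : T → T} (hg : IsWeakHomeo g) {x y z : T} : g z ∈ seg (g x) (g y) ↔ z ∈ seg x y := by
  rw [mem_seg_iff hT, mem_seg_iff hT, hg.1.1.eq_iff, hg.1.1.eq_iff, ← hg.2]

theorem dist_le_of_mem_seg {T : Type*} [MetricSpace T] (hT : IsRTree T) {x y z : T}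
    (h : z ∈ seg x y) : dist x z ≤ dist x y := by
  by_cases hxy : x = y
  · subst hxy
    rw [seg_self'] at h
    rw [mem_singleton_iff.mp h]
  · obtain ⟨φ, hi, him, h0, h1⟩ := seg_param hT hxy
    rw [← him] at h
    obtain ⟨s, hs, rfl⟩ := h
    have := hi 0 ⟨le_rfl, dist_nonneg⟩ s hs
    rw [h0] at this
    rw [this, zero_sub, abs_neg, abs_of_nonneg hs.1]
    exact hs.2

theorem mem_seg_of_isom {T : Type*} [MetricSpace T] (hT : IsRTree T) {φ : ℝ → T} {d s t : ℝ}
    (hi : ∀ s ∈ Icc (0 : ℝ) d, ∀ t ∈ Icc (0 : ℝ) d, dist (φ s) (φ t) = |s - t|)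
    (hs : 0 ≤ s) (hst : s ≤ t) (ht : t ≤ d) : φ s ∈ seg (φ 0) (φ t) := by
  rcases eq_or_lt_of_le (hs.trans hst) with h | h
  · have : s = t := by linarith
    rw [this, mem_seg_iff hT]
    simp
  have hm : ∀ u ∈ Icc (0 : ℝ) 1, t * u ∈ Icc 0 d := fun u hu =>
    ⟨mul_nonneg h.le hu.1, (mul_le_of_le_one_right h.le hu.2).trans ht⟩
  have hdist : ∀ u ∈ Icc (0 : ℝ) 1, ∀ v ∈ Icc (0 : ℝ) 1,
      dist (φ (t * u)) (φ (t * v)) = t * dist u v := by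
    intro u hu v hv
    rw [hi _ (hm u hu) _ (hm v hv), ← mul_sub, abs_mul, abs_of_pos h, Real.dist_eq]
  have hne : φ 0 ≠ φ t := by
    intro e
    have := hi 0 ⟨le_rfl, h.le.trans ht⟩ t ⟨h.le, ht⟩
    rw [e, dist_self, zero_sub, abs_neg, abs_of_pos h] at this
    linarith
  have harc : IsArc ((fun u => φ (t * u)) '' Icc 0 1) (φ 0) (φ t) := by
    refine ⟨fun u => φ (t * u), ?_, ?_, rfl, by simp, by simp⟩
    · rw [Metric.continuousOn_iff]
      intro u hu ε hε
      refine ⟨ε / t, div_pos hε h, fun v hv hvu => ?_⟩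
      rw [hdist v hv u hu, mul_comm]
      exact (lt_div_iff₀ h).mp hvu
    · intro u hu v hv e
      have := hdist u hu v hv
      simp only at e
      rw [e, dist_self] at this
      rcases mul_eq_zero.mp this.symm with h' | h'
      · linarith
      · exact dist_eq_zero.mp h'
  rw [seg_eq_of_isArc hT hne harc]
  exact ⟨s / t, ⟨div_nonneg hs h.le, (div_le_one h).mpr hst⟩, by
    simp only; rw [mul_div_cancel₀ _ (ne_of_gt h)]⟩

/-- A weak homeomorphism of an `ℝ`-tree maps each segment `[x,y]`
homeomorphically (w.r.t. the metric topology) onto its image, which is `[g x, g y]`. -/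
theorem weakHomeo_restrict_seg_embedding
    {T : Type*} [MetricSpace T] (hT : IsRTree T)
    (g : T → T) (hg : IsWeakHomeo g) :
    ∀ x y : T, g '' seg x y = seg (g x) (g y) ∧
      Topology.IsEmbedding ((seg x y).restrict g) := by
  intro x y
  have himg : g '' seg x y = seg (g x) (g y) := by
    ext w
    constructor
    · rintro ⟨z, hz, rfl⟩
      exact (mem_seg_map hT hg).mpr hz
    · intro hw
      obtain ⟨z, rfl⟩ := hg.1.2 w
      exact ⟨z, (mem_seg_map hT hg).mp hw, rfl⟩
  refine ⟨himg, ?_⟩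
  by_cases hxy : x = y
  · subst hxy
    have : Subsingleton (seg x x) := by
      rw [seg_self']; infer_instance
    exact Topology.IsEmbedding.of_subsingleton _
  have hgxy : g x ≠ g y := fun e => hxy (hg.1.1 e)
  obtain ⟨φ, hi, him, h0, h1⟩ := seg_param hT hxy
  obtain ⟨ψ, ki, kim, k0, k1⟩ := seg_param hT hgxy
  have hφc : ContinuousOn φ (Icc 0 (dist x y)) := by
    rw [Metric.continuousOn_iff]
    intro s hs ε hε
    refine ⟨ε, hε, fun t ht h => ?_⟩
    rw [hi t ht s hs, ← Real.dist_eq]; exact h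
  have hψc : ContinuousOn ψ (Icc 0 (dist (g x) (g y))) := by
    rw [Metric.continuousOn_iff]
    intro s hs ε hε
    refine ⟨ε, hε, fun t ht h => ?_⟩
    rw [ki t ht s hs, ← Real.dist_eq]; exact h
  have kd : ∀ u ∈ Icc 0 (dist (g x) (g y)), dist (g x) (ψ u) = u := by
    intro u hu
    have := ki 0 ⟨le_rfl, dist_nonneg⟩ u hu
    rwa [k0, zero_sub, abs_neg, abs_of_nonneg hu.1] at this
  have hd : ∀ u ∈ Icc 0 (dist x y), dist x (φ u) = u := by
    intro u hu
    have := hi 0 ⟨le_rfl, dist_nonneg⟩ u hu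
    rwa [h0, zero_sub, abs_neg, abs_of_nonneg hu.1] at this
  have hmem : ∀ u ∈ Icc 0 (dist x y), φ u ∈ seg x y := by
    intro u hu
    rw [← him]; exact mem_image_of_mem φ hu
  let H : Icc 0 (dist x y) → Icc 0 (dist (g x) (g y)) := fun s =>
    ⟨dist (g x) (g (φ s)), dist_nonneg,
      dist_le_of_mem_seg hT ((mem_seg_map hT hg).mpr (hmem s s.2))⟩
  have Hmono : Monotone H := by
    intro s t hst
    have := mem_seg_of_isom hT hi s.2.1 hst t.2.2
    rw [h0] at this
    exact dist_le_of_mem_seg hT ((mem_seg_map hT hg).mpr this)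
  have Hsurj : Function.Surjective H := by
    intro u
    have : ψ u ∈ g '' seg x y := by
      rw [himg, ← kim]; exact mem_image_of_mem ψ u.2
    obtain ⟨z, hz, hzu⟩ := this
    rw [← him] at hz
    obtain ⟨s, hs, rfl⟩ := hz
    refine ⟨⟨s, hs⟩, Subtype.ext ?_⟩
    change dist (g x) (g (φ s)) = u
    rw [hzu, kd u u.2]
  have Hc : Continuous H := Hmono.continuous_of_surjective Hsurj
  have hψ' : Continuous (fun u : Icc 0 (dist (g x) (g y)) => ψ u) := hψc.restrict
  let D : seg x y → Icc 0 (dist x y) := fun z =>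
    ⟨dist x z, dist_nonneg, dist_le_of_mem_seg hT z.2⟩
  have Dc : Continuous D := by
    apply Continuous.subtype_mk
    fun_prop
  have hcont : Continuous ((seg x y).restrict g) := by
    have e : (seg x y).restrict g = fun z => ψ (H (D z)) := by
      funext z
      obtain ⟨z, hz⟩ := z
      have hz' := hz
      rw [← him] at hz'
      obtain ⟨s, hs, rfl⟩ := hz'
      have hgz : g (φ s) ∈ seg (g x) (g y) := (mem_seg_map hT hg).mpr hz
      rw [← kim] at hgz
      obtain ⟨u, hu, hu'⟩ := hgz
      change g (φ s) = ψ (dist (g x) (g (φ (dist x (φ s)))))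
      rw [hd s hs, ← hu', kd u hu]
    rw [e]
    exact hψ'.comp (Hc.comp Dc)
  have hcomp : IsCompact (seg x y) := by
    rw [← him]; exact isCompact_Icc.image_of_continuousOn hφc
  have : CompactSpace (seg x y) := isCompact_iff_compactSpace.mp hcomp
  exact (hcont.isClosedEmbedding (hg.1.1.injOn.injective)).isEmbedding
end

section
/- Let T be an ℝ-tree and let A, B ⊆ T be two disjoint nonempty closed convex subsets. Then there exists a unique pair of points a ∈ A, b ∈ B such that for all x ∈ A and y ∈ B, [a,b] ⊆ [x,y]. -/
open Set

/-- Image of a compact interval under a continuous injective map is an arc. -/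
theorem isArc_of_Icc {T : Type*} [MetricSpace T] {f : ℝ → T} {c d : ℝ} (hcd : c < d)
    (hf : ContinuousOn f (Icc c d)) (hi : InjOn f (Icc c d)) :
    IsArc (f '' Icc c d) (f c) (f d) := by
  have hpos : 0 < d - c := by linarith
  have hmap : MapsTo (fun t : ℝ => c + t * (d - c)) (Icc 0 1) (Icc c d) := by
    intro t ht
    constructor
    · show c ≤ c + t * (d - c)
      nlinarith [ht.1]
    · show c + t * (d - c) ≤ d
      nlinarith [ht.2]
  refine ⟨fun t => f (c + t * (d - c)), ?_, ?_, ?_, by simp, by simp⟩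
  · exact hf.comp (by fun_prop) hmap
  · intro s hs t ht hst
    have h := hi (hmap hs) (hmap ht) hst
    simp only [add_right_inj] at h
    exact mul_right_cancel₀ hpos.ne' h
  · ext z
    constructor
    · rintro ⟨t, ht, rfl⟩
      exact ⟨_, hmap ht, rfl⟩
    · rintro ⟨u, hu, rfl⟩
      refine ⟨(u - c) / (d - c), ⟨div_nonneg (by linarith [hu.1]) hpos.le, ?_⟩, ?_⟩
      · rw [div_le_one hpos]
        linarith [hu.2]
      · show f (c + (u - c) / (d - c) * (d - c)) = f u
        rw [div_mul_cancel₀ _ hpos.ne']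
        congr 1
        ring

/-- Concatenation of arcs meeting only in the common endpoint. -/
theorem IsArc.concat {T : Type*} [MetricSpace T] {P Q : Set T} {x y z : T}
    (hP : IsArc P x y) (hQ : IsArc Q y z) (h : P ∩ Q ⊆ {y}) : IsArc (P ∪ Q) x z := by
  obtain ⟨f, hfc, hfi, rfl, rfl, rfl⟩ := hP
  obtain ⟨g, hgc, hgi, rfl, hg0, rfl⟩ := hQ
  let k : ℝ → T := fun t => if t ≤ 1 then f t else g (t - 1)
  have k1 : ∀ t ≤ (1 : ℝ), k t = f t := fun t ht => if_pos ht
  have k2 : ∀ t, (1 : ℝ) ≤ t → k t = g (t - 1) := by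
    intro t ht
    rcases ht.eq_or_lt with rfl | ht
    · rw [k1 1 le_rfl, sub_self, hg0]
    · exact if_neg (not_le.mpr ht)
  have hU : Icc (0 : ℝ) 2 = Icc 0 1 ∪ Icc 1 2 :=
    (Icc_union_Icc_eq_Icc (by norm_num) (by norm_num)).symm
  have hsub : MapsTo (fun t : ℝ => t - 1) (Icc 1 2) (Icc 0 1) := by
    intro t ht
    constructor
    · show 0 ≤ t - 1
      linarith [ht.1]
    · show t - 1 ≤ 1
      linarith [ht.2]
  have hc : ContinuousOn k (Icc 0 2) := by
    rw [hU]
    refine ContinuousOn.union_of_isClosed ?_ ?_ isClosed_Icc isClosed_Icc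
    · exact hfc.congr fun t ht => k1 t ht.2
    · exact (hgc.comp (by fun_prop) hsub).congr fun t ht => k2 t ht.1
  have key : ∀ s t : ℝ, s ∈ Icc (0 : ℝ) 1 → t ∈ Icc (1 : ℝ) 2 → k s = k t → s = t := by
    intro s t hs ht hst
    rw [k1 s hs.2, k2 t ht.1] at hst
    have h1 : f s = f 1 := h ⟨⟨s, hs, rfl⟩, ⟨t - 1, hsub ht, hst.symm⟩⟩
    have hs1 : s = 1 := hfi hs (by simp) h1
    have h2 : g (t - 1) = g 0 := by rw [← hst, h1, hg0]
    have := hgi (hsub ht) (by simp) h2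
    linarith
  have hi : InjOn k (Icc 0 2) := by
    intro s hs t ht hst
    rw [hU] at hs ht
    rcases hs with hs | hs <;> rcases ht with ht | ht
    · rw [k1 s hs.2, k1 t ht.2] at hst
      exact hfi hs ht hst
    · exact key s t hs ht hst
    · exact (key t s ht hs hst.symm).symm
    · rw [k2 s hs.1, k2 t ht.1] at hst
      have := hgi (hsub hs) (hsub ht) hst
      linarith
  have himg : k '' Icc 0 2 = f '' Icc 0 1 ∪ g '' Icc 0 1 := by
    rw [hU, image_union]
    congr 1
    · exact image_congr fun t ht => k1 t ht.2
    · rw [image_congr fun t (ht : t ∈ Icc (1 : ℝ) 2) => k2 t ht.1]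
      ext w
      constructor
      · rintro ⟨t, ht, rfl⟩
        exact ⟨_, hsub ht, rfl⟩
      · rintro ⟨t, ht, rfl⟩
        exact ⟨t + 1, ⟨by linarith [ht.1], by linarith [ht.2]⟩, by simp⟩
  have := isArc_of_Icc (by norm_num) hc hi
  rw [himg, k1 0 (by norm_num), k2 2 (by norm_num)] at this
  norm_num at this
  exact this

theorem IsArc.ne {T : Type*} [MetricSpace T] {P : Set T} {x y : T}
    (hP : IsArc P x y) : x ≠ y := by
  obtain ⟨f, hfc, hfi, rfl, rfl, rfl⟩ := hP
  intro h
  have := hfi (by simp) (by simp) h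
  norm_num at this

theorem IsArc.seg_eq {T : Type*} [MetricSpace T] (hT : IsRTree T) {P : Set T} {x y : T}
    (hP : IsArc P x y) : seg x y = P := by
  unfold seg
  rw [if_neg hP.ne]
  apply Subset.antisymm
  · exact sInter_subset_of_mem hP
  · exact subset_sInter fun Q hQ => ((hT.arc_existsUnique hP.ne).unique hP hQ).subset

theorem IsRTree.isArc_seg {T : Type*} [MetricSpace T] (hT : IsRTree T) {x y : T}
    (h : x ≠ y) : IsArc (seg x y) x y := by
  obtain ⟨P, hP, -⟩ := hT.arc_existsUnique h
  rw [hP.seg_eq hT]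
  exact hP

theorem IsArc.left_mem {T : Type*} [MetricSpace T] {P : Set T} {x y : T}
    (hP : IsArc P x y) : x ∈ P := by
  obtain ⟨f, hfc, hfi, rfl, rfl, rfl⟩ := hP
  exact ⟨0, by simp, rfl⟩

theorem IsArc.right_mem {T : Type*} [MetricSpace T] {P : Set T} {x y : T}
    (hP : IsArc P x y) : y ∈ P := by
  obtain ⟨f, hfc, hfi, rfl, rfl, rfl⟩ := hP
  exact ⟨1, by simp, rfl⟩

/-- Between two disjoint nonempty closed convex subsets `A, B`
of an `ℝ`-tree there is a unique bridge: a unique pair `(a, b) ∈ A × B` with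
`[a,b] ⊆ [x,y]` for all `x ∈ A`, `y ∈ B`. -/
theorem existsUnique_bridge
    {T : Type*} [MetricSpace T] (hT : IsRTree T)
    (A B : Set T) (hAne : A.Nonempty) (hBne : B.Nonempty) (hdisj : A ∩ B = ∅)
    (hAcl : IsClosed A) (hBcl : IsClosed B)
    (hAco : ConvexSubtree A) (hBco : ConvexSubtree B) :
    ∃! p : T × T, p.1 ∈ A ∧ p.2 ∈ B ∧
      ∀ x ∈ A, ∀ y ∈ B, seg p.1 p.2 ⊆ seg x y := by
  have hAB : ∀ z, z ∈ A → z ∈ B → False := fun z h1 h2 => by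
    have : z ∈ A ∩ B := ⟨h1, h2⟩
    rw [hdisj] at this
    exact this
  -- an arc from `A` to `B` meeting each only at its endpoint
  obtain ⟨P, a, b, haA, hbB, hP, hPA, hPB⟩ : ∃ (P : Set T) (a b : T), a ∈ A ∧ b ∈ B ∧
      IsArc P a b ∧ P ∩ A ⊆ {a} ∧ P ∩ B ⊆ {b} := by
    obtain ⟨x, hx⟩ := hAne
    obtain ⟨y, hy⟩ := hBne
    have hxy : x ≠ y := fun h => hAB x hx (h ▸ hy)
    obtain ⟨f, hfc, hfi, -, hf0, hf1⟩ := hT.isArc_seg hxy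
    have hS : IsCompact (Icc (0 : ℝ) 1 ∩ f ⁻¹' A) :=
      isCompact_Icc.of_isClosed_subset
        (hfc.preimage_isClosed_of_isClosed isClosed_Icc hAcl) inter_subset_left
    obtain ⟨s, ⟨hs, hsA⟩, hsmax⟩ := hS.exists_isGreatest ⟨0, by simp, by simpa [hf0] using hx⟩
    have hsubI : Icc s 1 ⊆ Icc 0 1 := Icc_subset_Icc_left hs.1
    have hR : IsCompact (Icc s 1 ∩ f ⁻¹' B) :=
      isCompact_Icc.of_isClosed_subset
        ((hfc.mono hsubI).preimage_isClosed_of_isClosed isClosed_Icc hBcl) inter_subset_left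
    obtain ⟨t, ⟨ht, htB⟩, htmin⟩ :=
      hR.exists_isLeast ⟨1, ⟨hs.2, le_rfl⟩, by simpa [hf1] using hy⟩
    have hst : s < t := by
      rcases ht.1.eq_or_lt with h | h
      · subst h
        exact (hAB _ hsA htB).elim
      · exact h
    have hsub : Icc s t ⊆ Icc 0 1 := Icc_subset_Icc hs.1 ht.2
    refine ⟨f '' Icc s t, f s, f t, hsA, htB,
      isArc_of_Icc hst (hfc.mono hsub) (hfi.mono hsub), ?_, ?_⟩
    · rintro _ ⟨⟨u, hu, rfl⟩, huA⟩
      have : u ≤ s := hsmax ⟨hsub hu, huA⟩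
      rw [le_antisymm this hu.1]
      rfl
    · rintro _ ⟨⟨u, hu, rfl⟩, huB⟩
      have : t ≤ u := htmin ⟨⟨hu.1, hu.2.trans ht.2⟩, huB⟩
      rw [le_antisymm hu.2 this]
      rfl
  have hseg := hP.seg_eq hT
  refine ⟨(a, b), ⟨haA, hbB, ?_⟩, ?_⟩
  · intro x hx y hy
    show seg a b ⊆ seg x y
    rw [hseg]
    -- extend on the left
    obtain ⟨Q, hQ, hPQ, hQB⟩ : ∃ Q, IsArc Q x b ∧ P ⊆ Q ∧ Q ∩ B ⊆ {b} := by
      by_cases hxa : x = a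
      · subst hxa
        exact ⟨P, hP, Subset.rfl, hPB⟩
      · have hxA := hAco x hx a haA
        refine ⟨seg x a ∪ P, (hT.isArc_seg hxa).concat hP ?_, subset_union_right, ?_⟩
        · rintro z ⟨h1, h2⟩
          exact hPA ⟨h2, hxA h1⟩
        · rintro z ⟨h1 | h1, h2⟩
          · exact (hAB z (hxA h1) h2).elim
          · exact hPB ⟨h1, h2⟩
    by_cases hby : b = y
    · subst hby
      rw [hQ.seg_eq hT]
      exact hPQ
    · have hyB := hBco b hbB y hy
      have := hQ.concat (hT.isArc_seg hby) (by
        rintro z ⟨h1, h2⟩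
        exact hQB ⟨h1, hyB h2⟩)
      rw [this.seg_eq hT]
      exact hPQ.trans subset_union_left
  · rintro ⟨a', b'⟩ ⟨ha', hb', h⟩
    simp only at ha' hb' h
    have hsub := h a haA b hbB
    have hne : a' ≠ b' := fun e => hAB a' ha' (e ▸ hb')
    have harc := hT.isArc_seg hne
    rw [hseg] at hsub
    have e1 : a' = a := hPA ⟨hsub harc.left_mem, ha'⟩
    have e2 : b' = b := hPB ⟨hsub harc.right_mem, hb'⟩
    rw [e1, e2]
end
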